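/- arXiv:1809.09812 — 2 statements merged into one kernel-verified Lean document; each statement's English description precedes it below -/
import Mathlib

section
/- Let M and W be n×n Hermitian matrices with M positive definite, let v, v₀ ∈ ℂⁿ, and suppose W − v v* ⪰ 0. If tr(W M) − v₀* M v − v* M v₀ + v₀* M v₀ = 0, then W = v v* and v = v₀. In other words, vanishing of the voltage penalty term forces tightness of the relaxation (the lifted matrix is rank-one and equals the outer product of the voltage vector) and agreement with the initial point. -/
open Matrix
open scoped ComplexOrder

section

variable {ι 𝕜 : Type*} [Fintype ι] [RCLike 𝕜]

open scoped MatrixOrder in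
lemma Matrix.PosSemidef.exists_eq_conjTranspose_mul_self {A : Matrix ι ι 𝕜}
    (hA : A.PosSemidef) : ∃ B : Matrix ι ι 𝕜, A = Bᴴ * B := by
  classical
  exact CStarAlgebra.nonneg_iff_eq_star_mul_self.mp hA.nonneg

lemma Matrix.PosSemidef.trace_mul_nonneg {A M : Matrix ι ι 𝕜}
    (hA : A.PosSemidef) (hM : M.PosSemidef) : 0 ≤ (A * M).trace := by
  obtain ⟨B, rfl⟩ := hA.exists_eq_conjTranspose_mul_self
  rw [Matrix.mul_assoc, trace_mul_comm]
  exact (hM.mul_mul_conjTranspose_same B).trace_nonneg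

lemma Matrix.PosSemidef.mul_eq_zero_of_trace_mul_eq_zero {A M : Matrix ι ι 𝕜}
    (hA : A.PosSemidef) (hM : M.PosSemidef) (h : (A * M).trace = 0) : A * M = 0 := by
  obtain ⟨B, rfl⟩ := hA.exists_eq_conjTranspose_mul_self
  obtain ⟨C, rfl⟩ := hM.exists_eq_conjTranspose_mul_self
  have hBC : B * Cᴴ = 0 := by
    rw [← trace_mul_conjTranspose_self_eq_zero_iff, ← h, Matrix.mul_assoc Bᴴ,
      trace_mul_comm Bᴴ]
    simp [Matrix.mul_assoc]
  rw [Matrix.mul_assoc, ← Matrix.mul_assoc B, hBC]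
  simp

lemma Matrix.PosSemidef.eq_zero_of_trace_mul_posDef_eq_zero {A M : Matrix ι ι 𝕜}
    (hA : A.PosSemidef) (hM : M.PosDef) (h : (A * M).trace = 0) : A = 0 := by
  classical
  exact (hM.isUnit.mul_left_eq_zero).mp (hA.mul_eq_zero_of_trace_mul_eq_zero hM.posSemidef h)

/-- The penalty splits into the trace gap of the relaxation and the squared `M`-distance
between `v` and `v₀`. -/
lemma Matrix.trace_penalty_eq (M W : Matrix ι ι 𝕜) (v v₀ : ι → 𝕜) :
    (W * M).trace - star v₀ ⬝ᵥ M *ᵥ v - star v ⬝ᵥ M *ᵥ v₀ + star v₀ ⬝ᵥ M *ᵥ v₀ =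
      ((W - vecMulVec v (star v)) * M).trace + star (v - v₀) ⬝ᵥ M *ᵥ (v - v₀) := by
  have hv : (vecMulVec v (star v) * M).trace = star v ⬝ᵥ M *ᵥ v := by
    rw [vecMulVec_mul, trace_vecMulVec, dotProduct_comm, dotProduct_mulVec]
  simp only [Matrix.sub_mul, trace_sub, hv, star_sub, mulVec_sub, sub_dotProduct, dotProduct_sub]
  ring

end

/-- If `M` is Hermitian positive definite, `W − v v* ⪰ 0`, and the voltage penalty term
`tr(W M) − v₀* M v − v* M v₀ + v₀* M v₀` vanishes, then `W = v v*` (the relaxation is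
tight) and `v = v₀` (the voltage agrees with the initial point). -/
theorem voltage_penalty_zero_tight {n : ℕ} (M W : Matrix (Fin n) (Fin n) ℂ)
    (v v₀ : Fin n → ℂ)
    (hM : M.PosDef) (hW : (W - vecMulVec v (star v)).PosSemidef)
    (hzero : (W * M).trace - star v₀ ⬝ᵥ M.mulVec v - star v ⬝ᵥ M.mulVec v₀
        + star v₀ ⬝ᵥ M.mulVec v₀ = 0) :
    W = vecMulVec v (star v) ∧ v = v₀ := by
  rw [trace_penalty_eq] at hzero
  obtain ⟨htr, hquad⟩ := (add_eq_zero_iff_of_nonneg (hW.trace_mul_nonneg hM.posSemidef)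
    (hM.posSemidef.dotProduct_mulVec_nonneg (v - v₀))).mp hzero
  refine ⟨sub_eq_zero.mp (hW.eq_zero_of_trace_mul_posDef_eq_zero hM htr), ?_⟩
  by_contra hne
  exact (hM.dotProduct_mulVec_pos (sub_ne_zero.mpr hne)).ne' hquad
end

section
/- Let τ > 0, θ ∈ ℝ, and y = g + i·b ∈ ℂ with g ≥ 0, let 0 ≤ η < 1, and let ζ = 1 if b ≤ 0 and ζ = −1 otherwise. With the branch matrices Y_p→, Y_p←, Y_q→, Y_q← defined from (τ, θ, y) as in the branch model, the 2×2 Hermitian matrix M_line = ζ·(Y_q→ + Y_q←) + (η/(1−η))·(Y_p→ + Y_p←) equals (|b| + (η/(1−η))·g)·[[1/τ², −e^{iθ}/τ],[−e^{−iθ}/τ, 1]] and is positive semidefinite. -/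
open Matrix
open scoped ComplexOrder

/-- The rank-one outer product of `(1/τ, -e^{-iθ})` with its conjugate is positive semidefinite. -/
theorem posSemidef_phaseShift (τ θ : ℝ) :
    (!![1 / (τ : ℂ) ^ 2, -Complex.exp (θ * Complex.I) / τ;
      -Complex.exp (-(θ * Complex.I)) / τ, 1]).PosSemidef := by
  have hconj : starRingEnd ℂ (Complex.exp (-(θ * Complex.I))) = Complex.exp (θ * Complex.I) := by
    rw [← Complex.exp_conj]
    simp
  have hmul : Complex.exp (-(θ * Complex.I)) * Complex.exp (θ * Complex.I) = 1 := by
    rw [← Complex.exp_add, neg_add_cancel, Complex.exp_zero]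
  convert posSemidef_vecMulVec_self_star ![1 / (τ : ℂ), -Complex.exp (-(θ * Complex.I))] using 1
  ext i j
  fin_cases i <;> fin_cases j <;> simp [vecMulVec_apply, hconj, hmul] <;> ring

/-- For a branch with series admittance `y = g + i·b` (`g ≥ 0`), tap ratio `τ > 0`, phase
shift `θ`, trade-off parameter `0 ≤ η < 1`, and sign `ζ = 1` if `b ≤ 0` and `ζ = −1`
otherwise, the per-line penalty matrix
`M_line = ζ·(Y_q→ + Y_q←) + (η/(1−η))·(Y_p→ + Y_p←)` equals
`(|b| + (η/(1−η))·g)·[[1/τ², −e^{iθ}/τ],[−e^{−iθ}/τ, 1]]` and is positive semidefinite. -/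
theorem line_penalty_matrix_psd (τ θ g b η : ℝ) (hτ : 0 < τ) (hg : 0 ≤ g)
    (hη₀ : 0 ≤ η) (hη₁ : η < 1) :
    let y : ℂ := g + b * Complex.I
    let eθ : ℂ := Complex.exp (θ * Complex.I)
    let Ypf : Matrix (Fin 2) (Fin 2) ℂ :=
      !![(g : ℂ) / τ ^ 2, -(eθ * y) / (2 * τ);
         -(starRingEnd ℂ y) / (2 * τ * eθ), 0]
    let Ypt : Matrix (Fin 2) (Fin 2) ℂ :=
      !![0, -(eθ * starRingEnd ℂ y) / (2 * τ);
         -y / (2 * τ * eθ), (g : ℂ)]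
    let Yqf : Matrix (Fin 2) (Fin 2) ℂ :=
      !![-(b : ℂ) / τ ^ 2, eθ * y / (2 * τ * Complex.I);
         -(starRingEnd ℂ y) / (2 * τ * Complex.I * eθ), 0]
    let Yqt : Matrix (Fin 2) (Fin 2) ℂ :=
      !![0, -(eθ * starRingEnd ℂ y) / (2 * τ * Complex.I);
         y / (2 * τ * Complex.I * eθ), -(b : ℂ)]
    let ζ : ℝ := if b ≤ 0 then 1 else -1
    let Mline : Matrix (Fin 2) (Fin 2) ℂ := ζ • (Yqf + Yqt) + (η / (1 - η)) • (Ypf + Ypt)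
    Mline = ((|b| + η / (1 - η) * g : ℝ) : ℂ) •
        !![1 / (τ : ℂ) ^ 2, -eθ / τ; -Complex.exp (-(θ * Complex.I)) / τ, 1] ∧
    Mline.PosSemidef := by
  intro y eθ Ypf Ypt Yqf Yqt ζ Mline
  have hζ : (ζ : ℂ) * b = -(|b| : ℝ) := by
    simp only [ζ]
    split_ifs with hb
    · simp [abs_of_nonpos hb]
    · simp [abs_of_pos (not_le.mp hb)]
  have hτ' : (τ : ℂ) ≠ 0 := by exact_mod_cast hτ.ne'
  have he : eθ ≠ 0 := Complex.exp_ne_zero _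
  have hy : starRingEnd ℂ y = g - b * Complex.I := by
    simp [y, sub_eq_add_neg]
  have hM : Mline = ((|b| + η / (1 - η) * g : ℝ) : ℂ) •
      !![1 / (τ : ℂ) ^ 2, -eθ / τ; -Complex.exp (-(θ * Complex.I)) / τ, 1] := by
    have hinv : Complex.exp (-(θ * Complex.I)) = eθ⁻¹ := Complex.exp_neg _
    have hb : ((|b| : ℝ) : ℂ) = -(ζ * b) := by rw [hζ, neg_neg]
    rw [hinv, Complex.ofReal_add, hb, Complex.ofReal_mul]
    simp only [Mline, Ypf, Ypt, Yqf, Yqt, hy]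
    simp only [y]
    clear_value ζ eθ
    generalize η / (1 - η) = c
    ext i j
    fin_cases i <;> fin_cases j <;> simp <;> field_simp <;> ring
  refine ⟨hM, ?_⟩
  rw [hM]
  refine (posSemidef_phaseShift τ θ).smul ?_
  have h1 : 0 < 1 - η := sub_pos.mpr hη₁
  exact_mod_cast (by positivity : 0 ≤ |b| + η / (1 - η) * g)
end
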